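/- Every 1-rational (a reduced rational with odd numerator and odd denominator) has exactly two infinite even-integer continued fraction expansions, and each of these expansions eventually alternates between 2 and −2. -/

import Mathlib

open Filter Topology OnePoint

/-- Inverse on ℚ ∪ {∞} (`Option.none` = ∞): 1/∞ = 0 and 1/0 = ∞. -/
def cfInv : Option ℚ → Option ℚ
  | Option.none => Option.some 0
  | Option.some q => if q = 0 then Option.none else Option.some q⁻¹

/-- Value of the finite continued fraction [b₁,…,bₙ] in ℚ ∪ {∞},
with `cfVal [] = Option.none` (that is, ∞). -/
def cfVal : List ℤ → Option ℚ
  | [] => Option.none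
  | b :: t => (cfInv (cfVal t)).map (fun q => (b : ℚ) + q)

/-- Embed ℚ ∪ {∞} into the extended real line ℝ ∪ {∞}. -/
def toOP : Option ℚ → OnePoint ℝ
  | Option.none => ∞
  | Option.some q => ((q : ℝ) : OnePoint ℝ)

/-- The n-th convergent (value of the first n+1 terms) of the continued fraction
with coefficients `b 0, b 1, …`. -/
def cfConv (b : ℕ → ℤ) (n : ℕ) : Option ℚ := cfVal ((List.range (n + 1)).map b)

/-- `b 0, b 1, …` is an even-integer continued fraction. -/
def IsEICF (b : ℕ → ℤ) : Prop := (∀ i, Even (b i)) ∧ ∀ i ≥ 1, b i ≠ 0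

/-- The even-integer continued fraction `b` is an expansion of `x`:
its convergents tend to `x` in the extended real line. -/
def IsEICFExpansion (b : ℕ → ℤ) (x : OnePoint ℝ) : Prop :=
  IsEICF b ∧ Tendsto (fun n => toOP (cfConv b n)) atTop (𝓝 x)


/-- The sequence `b` eventually alternates between 2 and −2. -/
def EventuallyAlternating (b : ℕ → ℤ) : Prop :=
  ∃ N, ∀ n ≥ N, (b n = 2 ∧ b (n + 1) = -2) ∨ (b n = -2 ∧ b (n + 1) = 2)

/-- Rational-valued convergents, computed recursively. -/
def cfR : ℕ → (ℕ → ℤ) → ℚ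
  | 0, b => (b 0 : ℚ)
  | n + 1, b => (b 0 : ℚ) + (cfR n (fun i => b (i + 1)))⁻¹

/-- Real-number version of being an expansion. -/
def EExp (b : ℕ → ℤ) (x : ℝ) : Prop :=
  IsEICF b ∧ Tendsto (fun n => ((cfR n b : ℚ) : ℝ)) atTop (𝓝 x)

/-- Prepend a term. -/
def sqCons (a : ℤ) (b : ℕ → ℤ) : ℕ → ℤ
  | 0 => a
  | n + 1 => b n

/-- The alternating sequence. -/
def sqAlt (s : ℤ) (n : ℕ) : ℤ := 2 * s * (-1) ^ n

theorem even_abs_ge {a : ℤ} (h : Even a) (h0 : a ≠ 0) : 2 ≤ |a| := by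
  obtain ⟨k, rfl⟩ := h
  rcases abs_cases (k + k) with h | h <;> omega

theorem cfR_abs_gt (n : ℕ) : ∀ b : ℕ → ℤ, (∀ i, Even (b i)) → (∀ i, b i ≠ 0) →
    1 < |cfR n b| := by
  induction n with
  | zero =>
    intro b he h0
    have h := even_abs_ge (he 0) (h0 0)
    have h' : (2 : ℚ) ≤ |(b 0 : ℚ)| := by exact_mod_cast h
    simp only [cfR]
    linarith
  | succ n ih =>
    intro b he h0
    have h := even_abs_ge (he 0) (h0 0)
    have h' : (2 : ℚ) ≤ |(b 0 : ℚ)| := by exact_mod_cast h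
    have h1 := ih (fun i => b (i + 1)) (fun i => he _) (fun i => h0 _)
    simp only [cfR]
    set y := cfR n (fun i => b (i + 1))
    have h2 : |y⁻¹| < 1 := by
      rw [abs_inv]
      exact inv_lt_one_of_one_lt₀ h1
    have h3 := abs_sub_abs_le_abs_sub (b 0 : ℚ) (-y⁻¹)
    rw [abs_neg, sub_neg_eq_add] at h3
    linarith

theorem cfConv_succ (b : ℕ → ℤ) (n : ℕ) :
    cfConv b (n + 1) =
      (cfInv (cfConv (fun i => b (i + 1)) n)).map (fun q => (b 0 : ℚ) + q) := by
  unfold cfConv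
  rw [List.range_succ_eq_map (n := n + 1)]
  simp only [List.map_cons, cfVal, List.map_map]
  rfl

theorem isEICF_shift {b : ℕ → ℤ} (hb : IsEICF b) : IsEICF (fun i => b (i + 1)) :=
  ⟨fun i => hb.1 _, fun i _ => hb.2 _ (by omega)⟩

theorem shift_abs_gt {b : ℕ → ℤ} (hb : IsEICF b) (n : ℕ) :
    1 < |cfR n (fun i => b (i + 1))| :=
  cfR_abs_gt n _ (fun i => hb.1 _) (fun i => hb.2 _ (by omega))

theorem cfConv_eq (n : ℕ) : ∀ b : ℕ → ℤ, IsEICF b → cfConv b n = Option.some (cfR n b) := by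
  induction n with
  | zero =>
    intro b hb
    simp [cfConv, cfVal, cfInv, cfR]
  | succ n ih =>
    intro b hb
    rw [cfConv_succ, ih _ (isEICF_shift hb)]
    have h := shift_abs_gt hb n
    have h0 : cfR n (fun i => b (i + 1)) ≠ 0 := by
      intro h0
      rw [h0] at h
      norm_num at h
    simp [cfInv, h0, cfR]

theorem isEICFExpansion_iff (b : ℕ → ℤ) (x : ℝ) :
    IsEICFExpansion b (x : OnePoint ℝ) ↔ EExp b x := by
  unfold IsEICFExpansion EExp
  refine and_congr_right fun hb => ?_
  have : (fun n => toOP (cfConv b n)) =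
      (fun y : ℝ => (y : OnePoint ℝ)) ∘ (fun n => ((cfR n b : ℚ) : ℝ)) := by
    funext n
    simp [cfConv_eq n b hb, toOP]
  rw [this]
  exact (OnePoint.isOpenEmbedding_coe.isInducing.tendsto_nhds_iff).symm

theorem EExp.abs_le {b : ℕ → ℤ} {x : ℝ} (h : EExp b x) : |x - b 0| ≤ 1 := by
  have h2 : Tendsto (fun n => |((cfR n b : ℚ) : ℝ) - b 0|) atTop (𝓝 |x - b 0|) :=
    (h.2.sub_const _).abs
  refine le_of_tendsto h2 (Eventually.of_forall fun n => ?_)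
  cases n with
  | zero => simp [cfR]
  | succ n =>
    have h3 := shift_abs_gt h.1 n
    have h4 : (1 : ℝ) < |((cfR n (fun i => b (i + 1)) : ℚ) : ℝ)| := by exact_mod_cast h3
    simp only [cfR]
    push_cast
    rw [add_sub_cancel_left, abs_inv]
    exact (inv_lt_one_of_one_lt₀ h4).le

theorem EExp.shift {b : ℕ → ℤ} {x : ℝ} (h : EExp b x) (hx : x - b 0 ≠ 0) :
    EExp (fun i => b (i + 1)) (x - b 0)⁻¹ := by
  refine ⟨isEICF_shift h.1, ?_⟩
  have h1 := (((tendsto_add_atTop_iff_nat 1).2 h.2).sub_const (b 0 : ℝ)).inv₀ hx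
  refine h1.congr fun n => ?_
  simp [cfR]

theorem EExp.cons {b : ℕ → ℤ} {y : ℝ} (h : EExp b y) (hy : y ≠ 0) (h0 : b 0 ≠ 0)
    {a : ℤ} (ha : Even a) : EExp (sqCons a b) (a + y⁻¹) := by
  refine ⟨⟨?_, ?_⟩, ?_⟩
  · intro i
    cases i with
    | zero => exact ha
    | succ i => exact h.1.1 i
  · intro i hi
    match i, hi with
    | 1, _ => exact h0
    | i + 2, _ => exact h.1.2 (i + 1) (by omega)
  · rw [← tendsto_add_atTop_iff_nat 1]
    refine ((h.2.inv₀ hy).const_add (a : ℝ)).congr fun n => ?_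
    simp [cfR, sqCons]

theorem eq_cons (d : ℕ → ℤ) : d = sqCons (d 0) (fun i => d (i + 1)) := by
  funext i
  cases i <;> rfl

theorem alt_cons {b : ℕ → ℤ} (h : EventuallyAlternating b) (a : ℤ) :
    EventuallyAlternating (sqCons a b) := by
  obtain ⟨N, hN⟩ := h
  refine ⟨N + 1, fun n hn => ?_⟩
  obtain ⟨m, rfl⟩ : ∃ m, n = m + 1 := ⟨n - 1, by omega⟩
  exact hN m (by omega)

theorem alt_alt {s : ℤ} (hs : s = 1 ∨ s = -1) : EventuallyAlternating (sqAlt s) := by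
  refine ⟨0, fun n _ => ?_⟩
  unfold sqAlt
  rw [pow_succ]
  rcases hs with rfl | rfl <;> rcases neg_one_pow_eq_or ℤ n with h | h <;> rw [h] <;> norm_num

theorem cfR_alt (n : ℕ) : ∀ s : ℤ, (s = 1 ∨ s = -1) →
    cfR n (sqAlt s) = s * ((n + 2) / (n + 1)) := by
  induction n with
  | zero =>
    intro s hs
    simp [cfR, sqAlt]
    ring
  | succ n ih =>
    intro s hs
    have h1 : (fun i => sqAlt s (i + 1)) = sqAlt (-s) := by
      funext i
      simp only [sqAlt, pow_succ]
      ring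
    have h2 := ih (-s) (by omega)
    have hn : (n : ℚ) + 1 ≠ 0 := by positivity
    have hn2 : (n : ℚ) + 2 ≠ 0 := by positivity
    have hn3 : (n : ℚ) + 1 + 1 ≠ 0 := by positivity
    simp only [cfR, h1, h2]
    rcases hs with rfl | rfl <;> simp [sqAlt] <;> field_simp <;> ring

theorem EExp_alt {s : ℤ} (hs : s = 1 ∨ s = -1) : EExp (sqAlt s) s := by
  refine ⟨⟨fun i => ⟨s * (-1) ^ i, by unfold sqAlt; ring⟩, fun i _ => ?_⟩, ?_⟩
  · unfold sqAlt
    have : s ≠ 0 := by omega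
    positivity
  · have h1 : Tendsto (fun n : ℕ => (s : ℝ) * (1 + 1 / ((n : ℝ) + 1))) atTop
        (𝓝 (s * (1 + 0))) :=
      (tendsto_one_div_add_atTop_nhds_zero_nat.const_add 1).const_mul _
    rw [add_zero, mul_one] at h1
    refine h1.congr fun n => ?_
    rw [cfR_alt n s hs]
    push_cast
    have hn : (n : ℝ) + 1 ≠ 0 := by positivity
    field_simp
    ring

theorem abs_le_one_int {k a : ℤ} (h : |(k : ℝ) - a| ≤ 1) : a - 1 ≤ k ∧ k ≤ a + 1 := by
  have h' : |k - a| ≤ 1 := by exact_mod_cast h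
  rw [abs_le] at h'
  omega

theorem alt_unique (n : ℕ) : ∀ (s : ℤ) (d : ℕ → ℤ), (s = 1 ∨ s = -1) → EExp d s → d 0 ≠ 0 →
    d n = sqAlt s n := by
  have key : ∀ (s : ℤ) (d : ℕ → ℤ), (s = 1 ∨ s = -1) → EExp d s → d 0 ≠ 0 → d 0 = 2 * s := by
    intro s d hs h h0
    have h1 := abs_le_one_int h.abs_le
    obtain ⟨k, hk⟩ := h.1.1 0
    omega
  induction n with
  | zero =>
    intro s d hs h h0
    simp [sqAlt, key s d hs h h0]
  | succ n ih =>
    intro s d hs h h0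
    have h1 := key s d hs h h0
    have h2 : (s : ℝ) - d 0 = ((-s : ℤ) : ℝ) := by rw [h1]; push_cast; ring
    have h3 : (((-s : ℤ) : ℝ))⁻¹ = ((-s : ℤ) : ℝ) := by
      rcases hs with rfl | rfl <;> norm_num
    have h4 : ((-s : ℤ) : ℝ) ≠ 0 := by
      rcases hs with rfl | rfl <;> norm_num
    have h5 := h.shift (by rw [h2]; exact h4)
    rw [h2, h3] at h5
    have h6 := ih (-s) _ (by omega) h5 (h.1.2 1 le_rfl)
    rw [h6]
    simp only [sqAlt, pow_succ]
    ring

/-- The conclusion, in real form. -/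
def TwoExp (x : ℝ) : Prop :=
  ∃ b c : ℕ → ℤ, b ≠ c ∧ EExp b x ∧ EExp c x ∧
    EventuallyAlternating b ∧ EventuallyAlternating c ∧
    ∀ d : ℕ → ℤ, EExp d x → d = b ∨ d = c

theorem twoExp_int {k : ℤ} (hk : Odd k) : TwoExp k := by
  have e1 : Even (k - 1) := hk.sub_odd odd_one
  have e2 : Even (k + 1) := hk.add_odd odd_one
  refine ⟨sqCons (k - 1) (sqAlt 1), sqCons (k + 1) (sqAlt (-1)), ?_, ?_, ?_,
    alt_cons (alt_alt (Or.inl rfl)) _, alt_cons (alt_alt (Or.inr rfl)) _, ?_⟩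
  · intro h
    have := congrFun h 0
    simp only [sqCons] at this
    omega
  · have h := (EExp_alt (s := 1) (Or.inl rfl)).cons (by norm_num) (by simp [sqAlt]) e1
    convert h using 1
    push_cast
    norm_num
  · have h := (EExp_alt (s := -1) (Or.inr rfl)).cons (by norm_num) (by simp [sqAlt]) e2
    convert h using 1
    push_cast
    norm_num
  · intro d hd
    have h1 := abs_le_one_int hd.abs_le
    obtain ⟨j, hj⟩ := hd.1.1 0
    obtain ⟨l, hl⟩ := hk
    rw [eq_cons d]
    have h2 : d 0 = k - 1 ∨ d 0 = k + 1 := by omega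
    rcases h2 with h2 | h2
    · left
      have h3 : (k : ℝ) - d 0 = ((1 : ℤ) : ℝ) := by rw [h2]; push_cast; ring
      have h5 := hd.shift (by rw [h3]; norm_num)
      rw [h3, Int.cast_one, inv_one, ← Int.cast_one] at h5
      rw [h2]
      congr 1
      funext n
      exact alt_unique n 1 _ (Or.inl rfl) h5 (hd.1.2 1 le_rfl)
    · right
      have h3 : (k : ℝ) - d 0 = ((-1 : ℤ) : ℝ) := by rw [h2]; push_cast; ring
      have h5 := hd.shift (by rw [h3]; norm_num)
      have h6 : ((-1 : ℤ) : ℝ)⁻¹ = ((-1 : ℤ) : ℝ) := by norm_num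
      rw [h3, h6] at h5
      rw [h2]
      congr 1
      funext n
      exact alt_unique n (-1) _ (Or.inr rfl) h5 (hd.1.2 1 le_rfl)

theorem twoExp_step {x : ℝ} {a : ℤ} (ha : Even a) (h0 : x - a ≠ 0) (h1 : |x - a| < 1)
    (h : TwoExp (x - a)⁻¹) : TwoExp x := by
  obtain ⟨b, c, hbc, hb, hc, ab, ac, hu⟩ := h
  have hy : 1 < |(x - a)⁻¹| := by
    rw [abs_inv]
    exact (one_lt_inv₀ (abs_pos.2 h0)).2 h1
  have nz : ∀ d : ℕ → ℤ, EExp d (x - a)⁻¹ → d 0 ≠ 0 := by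
    intro d hd hd0
    have := hd.abs_le
    rw [hd0, Int.cast_zero, sub_zero] at this
    linarith
  have hx : (a : ℝ) + ((x - a)⁻¹)⁻¹ = x := by rw [inv_inv]; ring
  refine ⟨sqCons a b, sqCons a c, ?_, ?_, ?_, alt_cons ab a, alt_cons ac a, ?_⟩
  · intro he
    apply hbc
    funext n
    exact congrFun he (n + 1)
  · have := hb.cons (inv_ne_zero h0) (nz b hb) ha
    rwa [hx] at this
  · have := hc.cons (inv_ne_zero h0) (nz c hc) ha
    rwa [hx] at this
  · intro d hd
    have h2 := hd.abs_le
    have h3 : |(d 0 : ℝ) - a| < 2 := by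
      have := abs_sub_le (d 0 : ℝ) x a
      rw [abs_sub_comm (d 0 : ℝ) x] at this
      linarith
    have h4 : |d 0 - a| < 2 := by exact_mod_cast h3
    have h5 : d 0 = a := by
      obtain ⟨j, hj⟩ := hd.1.1 0
      obtain ⟨l, hl⟩ := ha
      rw [abs_lt] at h4
      omega
    have h6 := hd.shift (by rw [h5]; exact h0)
    rw [h5] at h6
    rw [eq_cons d, h5]
    rcases hu _ h6 with h7 | h7
    · left; rw [h7]
    · right; rw [h7]

theorem exists_even_near (p q : ℤ) (hq : q ≠ 0) : ∃ a : ℤ, Even a ∧ |p - a * q| ≤ |q| := by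
  -- `a = 2 * m` with `m = (p + |q|) / (2 q)`
  have h2 : 2 * q ≠ 0 := by omega
  refine ⟨2 * ((p + |q|) / (2 * q)), even_two_mul _, ?_⟩
  have e := Int.emod_add_mul_ediv (p + |q|) (2 * q)
  have l := Int.emod_nonneg (p + |q|) h2
  have u := Int.emod_lt_abs (p + |q|) h2
  rw [abs_mul, abs_two] at u
  set m := (p + |q|) / (2 * q)
  have e2 : 2 * m * q = 2 * q * m := by ring
  rw [abs_le, e2]
  constructor <;> omega

theorem twoExp_main (n : ℕ) : ∀ p q : ℤ, Odd p → Odd q → q.natAbs ≤ n →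
    TwoExp ((p : ℝ) / q) := by
  induction n with
  | zero =>
    intro p q hp hq hn
    have : q = 0 := by omega
    subst this
    exact absurd hq (by decide)
  | succ n ih =>
    intro p q hp hq hn
    have hq0 : q ≠ 0 := by rintro rfl; exact absurd hq (by decide)
    have hqr : (q : ℝ) ≠ 0 := by exact_mod_cast hq0
    obtain ⟨a, ha, hle⟩ := exists_even_near p q hq0
    have hr : Odd (p - a * q) := hp.sub_even (ha.mul_right q)
    have hr0 : p - a * q ≠ 0 := by intro h; rw [h] at hr; exact absurd hr (by decide)
    have hx : (p : ℝ) / q - a = ((p - a * q : ℤ) : ℝ) / q := by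
      push_cast
      field_simp
    have hrr : ((p - a * q : ℤ) : ℝ) ≠ 0 := by exact_mod_cast hr0
    rcases hle.lt_or_eq with hlt | heq
    · apply twoExp_step ha
      · rw [hx]
        exact div_ne_zero hrr hqr
      · rw [hx, abs_div, div_lt_one (abs_pos.2 hqr)]
        exact_mod_cast hlt
      · rw [hx, inv_div]
        apply ih q _ hq hr
        have : (p - a * q).natAbs < q.natAbs := by
          rw [Int.abs_eq_natAbs, Int.abs_eq_natAbs] at hlt
          exact_mod_cast hlt
        omega
    · rcases abs_eq_abs.1 heq with h | h
      · have h1 : (p : ℝ) / q = ((a + 1 : ℤ) : ℝ) := by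
          have : p = (a + 1) * q := by linarith
          rw [this]
          push_cast
          field_simp
        rw [h1]
        exact twoExp_int (ha.add_odd odd_one)
      · have h1 : (p : ℝ) / q = ((a - 1 : ℤ) : ℝ) := by
          have : p = (a - 1) * q := by linarith
          rw [this]
          push_cast
          field_simp
        rw [h1]
        exact twoExp_int (ha.sub_odd odd_one)

/-- Every 1-rational has exactly two infinite even-integer continued fraction
expansions, and each of them eventually alternates between 2 and −2. -/
theorem eicf_expansions_of_one_rational (q : ℚ) (hnum : Odd q.num)
    (hden : Odd (q.den : ℤ)) :
    ∃ b c : ℕ → ℤ, b ≠ c ∧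
      IsEICFExpansion b ((q : ℝ) : OnePoint ℝ) ∧
      IsEICFExpansion c ((q : ℝ) : OnePoint ℝ) ∧
      EventuallyAlternating b ∧ EventuallyAlternating c ∧
      ∀ d : ℕ → ℤ, IsEICFExpansion d ((q : ℝ) : OnePoint ℝ) → d = b ∨ d = c := by
  have h := twoExp_main _ q.num q.den hnum hden le_rfl
  have hq : (q.num : ℝ) / ((q.den : ℤ) : ℝ) = (q : ℝ) := by
    rw [Rat.cast_def q]
    push_cast
    rfl
  rw [hq] at h
  simp only [isEICFExpansion_iff]
  exact h
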